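/- A legal abstract path has weight 1 if and only if it consists of a single interior abstract edge (one node, no arrows, with interior label). -/

import Mathlib

/-!
Statement 6: A legal abstract path has weight 1 if and only if it consists of a single
interior abstract edge.
-/

open scoped Classical

noncomputable section

/-- The three types of abstract vertices: interior, unstable, stable. -/
inductive VType : Type
  | o | u | s
deriving DecidableEq

/-- An abstract edge: an element of 𝔽₂ × ℕ³ × ℕ³, recording whether the edge is interior
(μ = 0) or boundary (μ = 1), and the numbers of incoming and outgoing ends of each type. -/
structure AbsEdge where
  mu : ZMod 2
  o1 : ℕ
  u1 : ℕ
  s1 : ℕ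
  o2 : ℕ
  u2 : ℕ
  s2 : ℕ

/-- The defining conditions of an abstract edge: interior edges have `s₁ = u₂ = 0` and
boundary edges have `o₁ = o₂ = 0`. -/
def AbsEdge.IsValid (ε : AbsEdge) : Prop :=
  (ε.mu = 0 → ε.s1 = 0 ∧ ε.u2 = 0) ∧ (ε.mu = 1 → ε.o1 = 0 ∧ ε.o2 = 0)

/-- Raw combinatorial data of an abstract path: a finite node set, an arrow set, a labeling
`τ` of nodes by abstract edges and a labeling `σ` of arrows by vertex types. -/
structure RawAbs where
  nodes : Finset ℕ
  arrows : Finset (ℕ × ℕ)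
  lab : ℕ → AbsEdge
  brk : ℕ × ℕ → VType

/-- The underlying undirected simple graph of the arrow set, on the node set. -/
def RawAbs.graph (r : RawAbs) : SimpleGraph {x // x ∈ r.nodes} :=
  SimpleGraph.fromRel (fun a b => ((a : ℕ), (b : ℕ)) ∈ r.arrows)

/-- The underlying data forms a (finite) non-empty directed tree. -/
def RawAbs.IsDirTree (r : RawAbs) : Prop :=
  r.nodes.Nonempty ∧
  (∀ e ∈ r.arrows, e.1 ∈ r.nodes ∧ e.2 ∈ r.nodes ∧ e.1 ≠ e.2) ∧
  (∀ a b : ℕ, (a, b) ∈ r.arrows → (b, a) ∉ r.arrows) ∧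
  r.graph.IsTree

/-- The number of incoming arrows at `v` labeled `t`. -/
def inDeg (r : RawAbs) (v : ℕ) (t : VType) : ℕ :=
  (r.arrows.filter fun e => e.2 = v ∧ r.brk e = t).card

/-- The number of outgoing arrows at `v` labeled `t`. -/
def outDeg (r : RawAbs) (v : ℕ) (t : VType) : ℕ :=
  (r.arrows.filter fun e => e.1 = v ∧ r.brk e = t).card

/-- The total number of incoming arrows at `v`. -/
def inDegAll (r : RawAbs) (v : ℕ) : ℕ := (r.arrows.filter fun e => e.2 = v).card

/-- The total number of outgoing arrows at `v`. -/
def outDegAll (r : RawAbs) (v : ℕ) : ℕ := (r.arrows.filter fun e => e.1 = v).card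

/-- `r` is an abstract path: the underlying data is a non-empty directed tree, the node labels
are abstract edges, and at every node the numbers of ends of each type dominate the numbers of
incident arrows of that type. -/
def IsAbsPath (r : RawAbs) : Prop :=
  r.IsDirTree ∧
  (∀ v ∈ r.nodes, (r.lab v).IsValid) ∧
  (∀ v ∈ r.nodes,
    inDeg r v .o ≤ (r.lab v).o1 ∧ inDeg r v .u ≤ (r.lab v).u1 ∧
    inDeg r v .s ≤ (r.lab v).s1 ∧ outDeg r v .o ≤ (r.lab v).o2 ∧
    outDeg r v .u ≤ (r.lab v).u2 ∧ outDeg r v .s ≤ (r.lab v).s2)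

/-- The weight of an abstract edge: `1` if interior, `2 − s₁ − u₂` if boundary. -/
def AbsEdge.w (ε : AbsEdge) : ℤ := if ε.mu = 0 then 1 else 2 - (ε.s1 : ℤ) - (ε.u2 : ℤ)

/-- The weight of an abstract path: the sum of the weights of its edges. -/
def weight (r : RawAbs) : ℤ := ∑ v ∈ r.nodes, (r.lab v).w

/-- `O(τ)`: the number of interior breaks. -/
def Ocnt (r : RawAbs) : ℕ := (r.arrows.filter fun e => r.brk e = .o).card

/-- `U(τ)`: the number of unstable breaks. -/
def Ucnt (r : RawAbs) : ℕ := (r.arrows.filter fun e => r.brk e = .u).card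

/-- `S(τ)`: the number of stable breaks. -/
def Scnt (r : RawAbs) : ℕ := (r.arrows.filter fun e => r.brk e = .s).card

/-- `B(τ)`: the number of boundary edges. -/
def Bcnt (r : RawAbs) : ℕ := (r.nodes.filter fun v => (r.lab v).mu = 1).card

/-- `s₁(τ) = Σ_v s₁(v) − #σ⁻¹(s)`: the number of free incoming stable ends. -/
def s1tot (r : RawAbs) : ℤ := (∑ v ∈ r.nodes, ((r.lab v).s1 : ℤ)) - Scnt r

/-- `s₂(τ) = Σ_v s₂(v) − #σ⁻¹(s)`: the number of free outgoing stable ends. -/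
def s2tot (r : RawAbs) : ℤ := (∑ v ∈ r.nodes, ((r.lab v).s2 : ℤ)) - Scnt r

/-- `u₂(τ) = Σ_v u₂(v) − #σ⁻¹(u)`: the number of free outgoing unstable ends. -/
def u2tot (r : RawAbs) : ℤ := (∑ v ∈ r.nodes, ((r.lab v).u2 : ℤ)) - Ucnt r

/-- An abstract path is legal if `s₁(τ) = u₂(τ) = 0`. -/
def Legal (r : RawAbs) : Prop := s1tot r = 0 ∧ u2tot r = 0

/-- The interior neighborhood of a node: the set of adjacent interior nodes. -/
def NbhdO (r : RawAbs) (v : ℕ) : Finset ℕ :=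
  r.nodes.filter fun x => (r.lab x).mu = 0 ∧ ((x, v) ∈ r.arrows ∨ (v, x) ∈ r.arrows)

/-- Contract the set of nodes `del ∪ {v}` to the single node `v`, relabeling it by `newLab`;
the arrow labels are transported along the induced bijection on the remaining arrows. -/
def contractTo (r : RawAbs) (del : Finset ℕ) (v : ℕ) (newLab : AbsEdge) : RawAbs :=
  let m : ℕ → ℕ := fun x => if x ∈ del then v else x
  { nodes := r.nodes \ del
    arrows := (r.arrows.filter fun e => ¬(m e.1 = v ∧ m e.2 = v)).image
      fun e => (m e.1, m e.2)
    lab := fun x => if x = v then newLab else r.lab x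
    brk := fun p =>
      if h : ∃ e ∈ r.arrows.filter fun e => ¬(m e.1 = v ∧ m e.2 = v),
          (m e.1, m e.2) = p then r.brk h.choose
      else r.brk p }

/-- The label `τ(s(e)) + τ(t(e)) − (0,(1,0,0),(1,0,0))` of the node produced by Move Ia. -/
def labIa (ε₁ ε₂ : AbsEdge) : AbsEdge :=
  ⟨ε₁.mu + ε₂.mu, ε₁.o1 + ε₂.o1 - 1, ε₁.u1 + ε₂.u1, ε₁.s1 + ε₂.s1,
    ε₁.o2 + ε₂.o2 - 1, ε₁.u2 + ε₂.u2, ε₁.s2 + ε₂.s2⟩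

/-- The label of the node produced by Move II: subtract `(1,(0,1,0),(0,1,0))` for an unstable
break and `(1,(0,0,1),(0,0,1))` for a stable break. -/
def labII (t : VType) (ε₁ ε₂ : AbsEdge) : AbsEdge :=
  match t with
  | .u => ⟨ε₁.mu + ε₂.mu + 1, ε₁.o1 + ε₂.o1, ε₁.u1 + ε₂.u1 - 1, ε₁.s1 + ε₂.s1,
      ε₁.o2 + ε₂.o2, ε₁.u2 + ε₂.u2 - 1, ε₁.s2 + ε₂.s2⟩
  | _ => ⟨ε₁.mu + ε₂.mu + 1, ε₁.o1 + ε₂.o1, ε₁.u1 + ε₂.u1, ε₁.s1 + ε₂.s1 - 1,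
      ε₁.o2 + ε₂.o2, ε₁.u2 + ε₂.u2, ε₁.s2 + ε₂.s2 - 1⟩

/-- The label `Σ_{v' ∈ Nbhd°(v)} τ(v') − τ(v) + (1,(0,0,0),(0,0,0))` of the node produced by
Move Ib. -/
def labIb (r : RawAbs) (v : ℕ) : AbsEdge :=
  ⟨(∑ x ∈ NbhdO r v, (r.lab x).mu) + (r.lab v).mu + 1,
    (∑ x ∈ NbhdO r v, (r.lab x).o1) - (r.lab v).o1,
    (∑ x ∈ NbhdO r v, (r.lab x).u1) - (r.lab v).u1,
    (∑ x ∈ NbhdO r v, (r.lab x).s1) - (r.lab v).s1,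
    (∑ x ∈ NbhdO r v, (r.lab x).o2) - (r.lab v).o2,
    (∑ x ∈ NbhdO r v, (r.lab x).u2) - (r.lab v).u2,
    (∑ x ∈ NbhdO r v, (r.lab x).s2) - (r.lab v).s2⟩

/-- Move Ia applies at the arrow `e` if both of its endpoints are interior nodes. -/
def CanIa (r : RawAbs) (e : ℕ × ℕ) : Prop :=
  e ∈ r.arrows ∧ (r.lab e.1).mu = 0 ∧ (r.lab e.2).mu = 0

/-- Move II applies at the arrow `e` if both of its endpoints are boundary nodes. -/
def CanII (r : RawAbs) (e : ℕ × ℕ) : Prop :=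
  e ∈ r.arrows ∧ (r.lab e.1).mu = 1 ∧ (r.lab e.2).mu = 1

/-- Move Ib applies at a boundary node `v` with `o₁(v) + s₁(v)` incoming arrows and
`o₂(v) + u₂(v)` outgoing arrows. -/
def CanIb (r : RawAbs) (v : ℕ) : Prop :=
  v ∈ r.nodes ∧ (r.lab v).mu = 1 ∧
  (r.lab v).o1 + (r.lab v).s1 = inDegAll r v ∧
  (r.lab v).o2 + (r.lab v).u2 = outDegAll r v

/-- Move Ia (interior): contract an arrow between interior nodes. -/
def glueIa (r : RawAbs) (e : ℕ × ℕ) : RawAbs :=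
  contractTo r {e.2} e.1 (labIa (r.lab e.1) (r.lab e.2))

/-- Move II (boundary): contract an arrow between boundary nodes. -/
def glueII (r : RawAbs) (e : ℕ × ℕ) : RawAbs :=
  contractTo r {e.2} e.1 (labII (r.brk e) (r.lab e.1) (r.lab e.2))

/-- Move Ib (boundary-obstructed): contract the interior star of a boundary node. -/
def glueIb (r : RawAbs) (v : ℕ) : RawAbs :=
  contractTo r (NbhdO r v) v (labIb r v)


/-- A directed tree has one more node than it has arrows. -/
theorem RawAbs.IsDirTree.card_arrows {r : RawAbs} (h : r.IsDirTree) :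
    r.arrows.card + 1 = r.nodes.card := by
  obtain ⟨-, hmem, hasymm, htree⟩ := h
  have hcard : r.arrows.card = r.graph.edgeFinset.card := by
    refine Finset.card_bij
      (fun e he => s(⟨e.1, (hmem e he).1⟩, ⟨e.2, (hmem e he).2.1⟩)) ?_ ?_ ?_
    · intro e he
      rw [SimpleGraph.mem_edgeFinset, SimpleGraph.mem_edgeSet, RawAbs.graph,
        SimpleGraph.fromRel_adj]
      exact ⟨fun hab => (hmem e he).2.2 (congrArg Subtype.val hab), Or.inl he⟩
    · rintro ⟨a, b⟩ hab ⟨c, d⟩ hcd heq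
      simp only [Sym2.eq_iff, Subtype.mk.injEq] at heq
      rcases heq with ⟨rfl, rfl⟩ | ⟨rfl, rfl⟩
      · rfl
      · exact absurd hcd (hasymm _ _ hab)
    · intro e
      induction e using Sym2.ind with
      | _ a b =>
        intro he
        rw [SimpleGraph.mem_edgeFinset, SimpleGraph.mem_edgeSet, RawAbs.graph,
          SimpleGraph.fromRel_adj] at he
        rcases he.2 with hab | hba
        · exact ⟨(a, b), hab, rfl⟩
        · exact ⟨(b, a), hba, Sym2.eq_swap⟩
  rw [hcard, htree.card_edgeFinset, Fintype.card_coe]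

/-- Every arrow is an interior, an unstable or a stable break. -/
theorem card_arrows_eq_Ocnt_add_Ucnt_add_Scnt (r : RawAbs) :
    r.arrows.card = Ocnt r + Ucnt r + Scnt r := by
  rw [Finset.card_eq_sum_ones]
  simp only [Ocnt, Ucnt, Scnt, Finset.card_filter, ← Finset.sum_add_distrib]
  refine Finset.sum_congr rfl fun e _ => ?_
  cases r.brk e <;> simp

theorem AbsEdge.IsValid.w_add {ε : AbsEdge} (h : ε.IsValid) :
    ε.w + ε.s1 + ε.u2 = 1 + if ε.mu = 1 then 1 else 0 := by
  have hmu : ∀ x : ZMod 2, x = 0 ∨ x = 1 := by decide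
  rcases hmu ε.mu with h0 | h1
  · simp [AbsEdge.w, h0, h.1 h0]
  · simp only [AbsEdge.w, h1, one_ne_zero, if_false, if_true]
    ring

/-- The weight of a legal abstract path is `B(τ) + O(τ) + 1`. -/
theorem weight_eq_of_legal {r : RawAbs} (h : IsAbsPath r) (hleg : Legal r) :
    weight r = Bcnt r + Ocnt r + 1 := by
  obtain ⟨htree, hvalid, -⟩ := h
  obtain ⟨hs, hu⟩ := hleg
  have hsum := Finset.sum_congr (rfl : r.nodes = r.nodes) fun v hv => (hvalid v hv).w_add
  simp only [Finset.sum_add_distrib, Finset.sum_const, Finset.sum_boole, nsmul_eq_mul,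
    mul_one] at hsum
  have hcard := htree.card_arrows
  have hbreaks := card_arrows_eq_Ocnt_add_Ucnt_add_Scnt r
  simp only [s1tot, u2tot] at hs hu
  simp only [weight, Bcnt]
  omega

/-- A legal abstract path has weight 1 if and only if it consists of a single
interior abstract edge (one node, no arrows, with interior label). -/
theorem legal_weight_one_iff_single_interior_edge (r : RawAbs) (h : IsAbsPath r)
    (hleg : Legal r) :
    weight r = 1 ↔
      r.nodes.card = 1 ∧ r.arrows = ∅ ∧ ∀ v ∈ r.nodes, (r.lab v).mu = 0 := by
  have hweight := weight_eq_of_legal h hleg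
  obtain ⟨htree, hvalid, -⟩ := h
  have hcard := htree.card_arrows
  constructor
  · intro hw
    have hmu : ∀ v ∈ r.nodes, (r.lab v).mu = 0 := by
      intro v hv
      have hB : Bcnt r = 0 := by omega
      rw [Bcnt, Finset.card_eq_zero, Finset.filter_eq_empty_iff] at hB
      have hcases : ∀ x : ZMod 2, x ≠ 1 → x = 0 := by decide
      exact hcases _ (hB hv)
    have hs : ∑ v ∈ r.nodes, ((r.lab v).s1 : ℤ) = 0 :=
      Finset.sum_eq_zero fun v hv => by simp [((hvalid v hv).1 (hmu v hv)).1]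
    have hu : ∑ v ∈ r.nodes, ((r.lab v).u2 : ℤ) = 0 :=
      Finset.sum_eq_zero fun v hv => by simp [((hvalid v hv).1 (hmu v hv)).2]
    have hbreaks := card_arrows_eq_Ocnt_add_Ucnt_add_Scnt r
    obtain ⟨hs', hu'⟩ := hleg
    rw [s1tot] at hs'
    rw [u2tot] at hu'
    have harrows : r.arrows.card = 0 := by omega
    exact ⟨by omega, Finset.card_eq_zero.mp harrows, hmu⟩
  · rintro ⟨-, harrows, hmu⟩
    have hB : Bcnt r = 0 := by
      rw [Bcnt, Finset.card_eq_zero, Finset.filter_eq_empty_iff]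
      intro v hv
      simp [hmu v hv]
    have hO : Ocnt r = 0 := by simp [Ocnt, harrows]
    omega

end
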